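/- Let X be a continuously distributed random variable on an atomless probability space, let β ∈ (0,1), let Y be a random variable with Y ↑_β X, set B = A^X_{1−β}, and let α ∈ (0,1) with α > β. Then Q_α(Y) = Q_{α−β}(z·1_B + Y·1_{B^c}) for every z ≤ Q_α(Y). -/

import Mathlib

open MeasureTheory Set

/-- Value-at-Risk at level `p`: `VaR_p(X) = inf {x ∈ ℝ : ℙ(X ≤ x) > p}`. -/
noncomputable def VaR {Ω : Type*} [MeasurableSpace Ω] (μ : Measure Ω) (X : Ω → ℝ) (p : ℝ) : ℝ :=
  sInf {x : ℝ | p < (μ {ω | X ω ≤ x}).toReal}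

/-- The upper-tail event `A^X_p = {ω ∈ Ω : X ω > VaR_p(X)}`. -/
def tailSet {Ω : Type*} [MeasurableSpace Ω] (μ : Measure Ω) (X : Ω → ℝ) (p : ℝ) : Set Ω :=
  {ω | VaR μ X p < X ω}

/-- `X` is continuously distributed under `μ`. -/
def ContinuouslyDistributed {Ω : Type*} [MeasurableSpace Ω] (μ : Measure Ω) (X : Ω → ℝ) : Prop :=
  ∀ x : ℝ, μ {ω | X ω = x} = 0

/-- `μ` is an atomless measure: every non-null measurable set has a measurable subset of
strictly smaller positive measure. -/
def Atomless {Ω : Type*} [MeasurableSpace Ω] (μ : Measure Ω) : Prop :=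
  ∀ s : Set Ω, MeasurableSet s → 0 < μ s →
    ∃ t ⊆ s, MeasurableSet t ∧ 0 < μ t ∧ μ t < μ s

/-- `X` and `Y` are weakly comonotonic with respect to the product measure `π₁ × π₂`:
`∬ (X ω − X ω')(Y ω − Y ω') π₁(dω) π₂(dω') ≥ 0`. -/
def WeaklyComonotonic {Ω : Type*} [MeasurableSpace Ω] (X Y : Ω → ℝ)
    (π₁ π₂ : Measure Ω) : Prop :=
  0 ≤ ∫ q : Ω × Ω, (X q.1 - X q.2) * (Y q.1 - Y q.2) ∂(π₁.prod π₂)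

/-- `X` and `Y` are weakly antimonotonic with respect to the product measure `π₁ × π₂`:
`∬ (X ω − X ω')(Y ω − Y ω') π₁(dω) π₂(dω') ≤ 0`. -/
def WeaklyAntimonotonic {Ω : Type*} [MeasurableSpace Ω] (X Y : Ω → ℝ)
    (π₁ π₂ : Measure Ω) : Prop :=
  ∫ q : Ω × Ω, (X q.1 - X q.2) * (Y q.1 - Y q.2) ∂(π₁.prod π₂) ≤ 0

/-- Left quantile at level `α`: `Q_α(Y) = inf {x ∈ ℝ : ℙ(Y ≤ x) ≥ 1 − α}`. -/
noncomputable def Qleft {Ω : Type*} [MeasurableSpace Ω] (μ : Measure Ω) (Y : Ω → ℝ) (α : ℝ) : ℝ :=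
  sInf {x : ℝ | 1 - α ≤ (μ {ω | Y ω ≤ x}).toReal}

/-- `Y ↑_β Z`: `Y` and `Z` are weakly comonotonic with respect to
`∪_{p ∈ [1−β, 1)} 𝒫^Z_p` (no constraint when `β = 0`). -/
def UpBeta {Ω : Type*} [MeasurableSpace Ω] (μ : Measure Ω) (Y Z : Ω → ℝ) (β : ℝ) : Prop :=
  ∀ p ∈ Set.Ico (1 - β) 1, ∀ ω ∈ tailSet μ Z p, ∀ ω' ∉ tailSet μ Z p,
    WeaklyComonotonic Y Z (Measure.dirac ω) (Measure.dirac ω')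

open Filter Topology ProbabilityTheory

section

variable {Ω : Type*} [MeasurableSpace Ω] {μ : Measure Ω} {X Y : Ω → ℝ}

theorem toReal_measure_le_eq_cdf [IsProbabilityMeasure μ] (hX : Measurable X) (x : ℝ) :
    (μ {ω | X ω ≤ x}).toReal = cdf (μ.map X) x := by
  have := Measure.isProbabilityMeasure_map (μ := μ) hX.aemeasurable
  rw [cdf_eq_real, measureReal_def, Measure.map_apply hX measurableSet_Iic]
  rfl

theorem bddBelow_setOf_le_cdf (ν : Measure ℝ) {p : ℝ} (hp : 0 < p) :
    BddBelow {x : ℝ | p ≤ cdf ν x} := by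
  obtain ⟨a, ha⟩ := ((tendsto_cdf_atBot ν).eventually (gt_mem_nhds hp)).exists
  refine ⟨a, fun x hx => ?_⟩
  by_contra! h
  exact absurd (hx.trans (monotone_cdf ν h.le)) ha.not_ge

theorem toReal_measure_le_VaR [IsProbabilityMeasure μ] (hX : Measurable X)
    (hXc : ContinuouslyDistributed μ X) {p : ℝ} (hp : p ∈ Ioo (0 : ℝ) 1) :
    (μ {ω | X ω ≤ VaR μ X p}).toReal = p := by
  have := Measure.isProbabilityMeasure_map (μ := μ) hX.aemeasurable
  have hv : VaR μ X p = sInf {x | p < cdf (μ.map X) x} := by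
    simp only [VaR, toReal_measure_le_eq_cdf hX]
  rw [toReal_measure_le_eq_cdf hX]
  set F := cdf (μ.map X)
  set v := VaR μ X p
  have hne : {x | p < F x}.Nonempty :=
    ((tendsto_cdf_atTop (μ.map X)).eventually (lt_mem_nhds hp.2)).exists
  have hbdd : BddBelow {x | p < F x} :=
    (bddBelow_setOf_le_cdf (μ.map X) hp.1).mono fun x (hx : p < F x) => hx.le
  have hatom : F v ≤ Function.leftLim F v := by
    have h := F.measure_singleton v
    rw [measure_cdf, Measure.map_apply hX (measurableSet_singleton v)] at h
    have h0 : μ (X ⁻¹' {v}) = 0 := hXc v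
    rw [h0] at h
    simpa using ENNReal.ofReal_eq_zero.1 h.symm
  apply le_antisymm
  · refine hatom.trans (le_of_tendsto (F.mono.tendsto_leftLim v) ?_)
    filter_upwards [self_mem_nhdsWithin] with x hx
    have hxv : x ∉ {x | p < F x} := notMem_of_lt_csInf (hx.trans_eq hv) hbdd
    exact not_lt.1 hxv
  · refine ge_of_tendsto (((F.right_continuous v).mono Ioi_subset_Ici_self).tendsto) ?_
    filter_upwards [self_mem_nhdsWithin] with x hx
    obtain ⟨y, hy, hyx⟩ := exists_lt_of_csInf_lt hne (hv ▸ hx : sInf _ < x)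
    exact hy.le.trans (F.mono hyx.le)

theorem measurableSet_tailSet (hX : Measurable X) (p : ℝ) : MeasurableSet (tailSet μ X p) :=
  measurableSet_lt measurable_const hX

theorem measureReal_compl_tailSet [IsProbabilityMeasure μ] (hX : Measurable X)
    (hXc : ContinuouslyDistributed μ X) {p : ℝ} (hp : p ∈ Ioo (0 : ℝ) 1) :
    μ.real (tailSet μ X p)ᶜ = p := by
  have h : (tailSet μ X p)ᶜ = {ω | X ω ≤ VaR μ X p} := by
    ext ω
    simp [tailSet]
  rw [h, measureReal_def, toReal_measure_le_VaR hX hXc hp]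

theorem UpBeta.le_of_mem_tailSet (hX : Measurable X) (hY : Measurable Y) {β p : ℝ}
    (hup : UpBeta μ Y X β) (hp : p ∈ Ico (1 - β) 1) {ω ω' : Ω}
    (hω : ω ∈ tailSet μ X p) (hω' : ω' ∉ tailSet μ X p) : Y ω' ≤ Y ω := by
  have h := hup p hp ω hω ω' hω'
  have hm : StronglyMeasurable fun q : Ω × Ω => (Y q.1 - Y q.2) * (X q.1 - X q.2) :=
    Measurable.stronglyMeasurable (by fun_prop)
  rw [WeaklyComonotonic, Measure.dirac_prod_dirac, integral_dirac' _ _ hm] at h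
  have hlt : X ω' < X ω := (not_lt.1 hω').trans_lt hω
  exact sub_nonneg.1 (nonneg_of_mul_nonneg_left h (sub_pos.2 hlt))

end

/-- Lemma 6.2(ii) (Wang–Zitikis, "Weak comonotonicity"). If `Y ↑_β X`, `B = A^X_{1−β}`
and `α > β`, then `Q_α(Y) = Q_{α−β}(z·1_B + Y·1_{Bᶜ})` for every `z ≤ Q_α(Y)`. -/
theorem upBeta_quantile_replace_tail {Ω : Type*} [MeasurableSpace Ω]
    (μ : Measure Ω) [IsProbabilityMeasure μ] (hμ : Atomless μ)
    (X : Ω → ℝ) (hX : Measurable X) (hXc : ContinuouslyDistributed μ X)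
    (β : ℝ) (hβ : β ∈ Set.Ioo (0 : ℝ) 1)
    (Y : Ω → ℝ) (hY : Measurable Y) (hup : UpBeta μ Y X β)
    (α : ℝ) (hα : α ∈ Set.Ioo (0 : ℝ) 1) (hαβ : β < α) :
    ∀ z : ℝ, z ≤ Qleft μ Y α →
      Qleft μ Y α =
        Qleft μ (fun ω => (tailSet μ X (1 - β)).indicator (fun _ => z) ω
          + ((tailSet μ X (1 - β))ᶜ).indicator Y ω) (α - β) := by
  intro z hz
  set B := tailSet μ X (1 - β)
  have hB : MeasurableSet B := measurableSet_tailSet hX _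
  have hBc : μ.real Bᶜ = 1 - β :=
    measureReal_compl_tailSet hX hXc ⟨by linarith [hβ.2], by linarith [hβ.1]⟩
  have hBβ : μ.real B = β := by linarith [probReal_add_probReal_compl (μ := μ) hB]
  unfold Qleft
  congr 1
  ext x
  simp only [mem_ofPred_eq, ← measureReal_def]
  set G := {ω | B.indicator (fun _ => z) ω + Bᶜ.indicator Y ω ≤ x} with hG
  have hGc : G \ B = {ω | Y ω ≤ x} \ B := by
    ext ω
    by_cases hω : ω ∈ B <;> simp [hG, hω]
  have hFadd := measureReal_inter_add_sdiff (μ := μ) (s := {ω | Y ω ≤ x}) hB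
  have hGadd := measureReal_inter_add_sdiff (μ := μ) (s := G) hB
  rw [hGc] at hGadd
  rcases lt_or_ge x z with hx | hx
  · have hGB : G ∩ B = ∅ := by
      ext ω
      by_cases hω : ω ∈ B <;> simp [hG, hω, hx]
    have hF : μ.real {ω | Y ω ≤ x} < 1 - α := by
      have hbdd : BddBelow {x | 1 - α ≤ (μ {ω | Y ω ≤ x}).toReal} := by
        simp only [toReal_measure_le_eq_cdf hY]
        exact bddBelow_setOf_le_cdf _ (sub_pos.2 hα.2)
      have hxQ := notMem_of_lt_csInf (hx.trans_le hz) hbdd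
      exact not_le.1 hxQ
    rw [hGB, measureReal_empty] at hGadd
    have := measureReal_nonneg (μ := μ) (s := {ω | Y ω ≤ x} ∩ B)
    constructor <;> intro h <;> linarith [hβ.1]
  · have hGB : G ∩ B = B := by
      ext ω
      by_cases hω : ω ∈ B <;> simp [hG, hω, hx]
    rw [hGB, hBβ] at hGadd
    rcases ({ω | Y ω ≤ x} ∩ B).eq_empty_or_nonempty with h0 | ⟨ω, hω, hωB⟩
    · rw [h0, measureReal_empty] at hFadd
      constructor <;> intro h <;> linarith
    · have hFB : {ω | Y ω ≤ x} \ B = Bᶜ := by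
        ext ω'
        refine ⟨fun h => h.2, fun h => ⟨?_, h⟩⟩
        exact (hup.le_of_mem_tailSet hX hY ⟨le_rfl, by linarith [hβ.1]⟩ hωB h).trans hω
      rw [hFB, hBc] at hGadd hFadd
      have := measureReal_nonneg (μ := μ) (s := {ω | Y ω ≤ x} ∩ B)
      constructor <;> intro _ <;> linarith
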